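/- There exists a separable Banach space U_∞ which admits an equivalent AUF norm and which is both injectively and surjectively universal for the class of separable AUF-able spaces: every separable Banach space admitting an equivalent AUF norm is isomorphic to a closed subspace of U_∞, and is also a quotient of U_∞ (i.e., there is a surjective bounded linear map from U_∞ onto it). -/

import Mathlib

open Metric Set Topology Filter

noncomputable def rhoN (X : Type*) [NormedAddCommGroup X] [NormedSpace ℝ X]
    (N : X → ℝ) (τ : ℝ) : ℝ :=
  letI := Classical.propDecidable (FiniteDimensional ℝ X)
  if FiniteDimensional ℝ X then 0
  else
    sSup { r : ℝ | ∃ y : X, N y ≤ 1 ∧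
      r = sInf { s : ℝ | ∃ E : Submodule ℝ X, IsClosed (E : Set X) ∧
            FiniteDimensional ℝ (X ⧸ E) ∧
            s = sSup { t : ℝ | ∃ x ∈ E, N x ≤ 1 ∧ t = N (y + τ • x) - 1 } } }

noncomputable def rho (X : Type*) [NormedAddCommGroup X] [NormedSpace ℝ X] (τ : ℝ) : ℝ :=
  rhoN X (fun x => ‖x‖) τ

def IsNormFn (X : Type*) [NormedAddCommGroup X] [NormedSpace ℝ X] (N : X → ℝ) : Prop :=
  (∀ x : X, 0 ≤ N x) ∧ (∀ x : X, N x = 0 ↔ x = 0) ∧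
    (∀ (a : ℝ) (x : X), N (a • x) = |a| * N x) ∧ ∀ x y : X, N (x + y) ≤ N x + N y

def IsEquivNorm (X : Type*) [NormedAddCommGroup X] [NormedSpace ℝ X] (N : X → ℝ) : Prop :=
  IsNormFn X N ∧ ∃ a > 0, ∃ b > 0, ∀ x : X, a * ‖x‖ ≤ N x ∧ N x ≤ b * ‖x‖

def IsPAUSNorm (X : Type*) [NormedAddCommGroup X] [NormedSpace ℝ X] (N : X → ℝ) (p : ℝ) : Prop :=
  ∃ C > 0, ∀ τ : ℝ, 0 ≤ τ → rhoN X N τ ≤ C * τ ^ p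

def PAUSable (p : ℝ) (X : Type*) [NormedAddCommGroup X] [NormedSpace ℝ X] : Prop :=
  ∃ N : X → ℝ, IsEquivNorm X N ∧ IsPAUSNorm X N p

def IsomToClosedSubspace (Y U : Type*) [NormedAddCommGroup Y] [NormedSpace ℝ Y]
    [NormedAddCommGroup U] [NormedSpace ℝ U] : Prop :=
  ∃ T : Y →L[ℝ] U, Function.Injective T ∧ ∃ c > 0, ∀ y : Y, c * ‖y‖ ≤ ‖T y‖

def IsQuotientOf (Y U : Type*) [NormedAddCommGroup Y] [NormedSpace ℝ Y]
    [NormedAddCommGroup U] [NormedSpace ℝ U] : Prop :=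
  ∃ Q : U →L[ℝ] Y, Function.Surjective Q


def IsAUFNorm (X : Type*) [NormedAddCommGroup X] [NormedSpace ℝ X] (N : X → ℝ) : Prop :=
  ∃ τ₀ : ℝ, 0 < τ₀ ∧ rhoN X N τ₀ = 0

def AUFable (X : Type*) [NormedAddCommGroup X] [NormedSpace ℝ X] : Prop :=
  ∃ N : X → ℝ, IsEquivNorm X N ∧ IsAUFNorm X N

universe u

section Cofinite

variable {X : Type*} [NormedAddCommGroup X] [NormedSpace ℝ X]

/-- Closed subspaces of finite codimension. -/
def ClosedCofinite (D : Submodule ℝ X) : Prop :=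
  IsClosed (D : Set X) ∧ FiniteDimensional ℝ (X ⧸ D)

lemma ClosedCofinite.top : ClosedCofinite (⊤ : Submodule ℝ X) :=
  ⟨isClosed_univ, inferInstance⟩

lemma ClosedCofinite.inf {D D' : Submodule ℝ X} (h : ClosedCofinite D) (h' : ClosedCofinite D') :
    ClosedCofinite (D ⊓ D') :=
  ⟨h.1.inter h'.1, Submodule.CoFG.inf h.2 h'.2⟩

lemma ClosedCofinite.mono {D D' : Submodule ℝ X} (h : ClosedCofinite D) (hD : D ≤ D') :
    ClosedCofinite D' := by
  have := h.2
  exact ⟨Submodule.isClosed_mono_of_finiteDimensional_quotient h.1 hD, Submodule.CoFG.of_le hD h.2⟩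

lemma ClosedCofinite.ker {V : Type*} [NormedAddCommGroup V] [NormedSpace ℝ V]
    [FiniteDimensional ℝ V] (f : X →L[ℝ] V) : ClosedCofinite f.ker :=
  ⟨f.isClosed_ker, Submodule.CoFG.ker _⟩

/-- A property which holds locally for points of a compact set, on a closed subspace of finite
codimension, holds on a common such subspace. -/
lemma IsCompact.exists_closedCofinite {K : Set X} (hK : IsCompact K) (R : X → X → Prop)
    (h : ∀ y ∈ K, ∃ D : Submodule ℝ X, ClosedCofinite D ∧ ∀ᶠ y' in 𝓝[K] y, ∀ e ∈ D, R y' e) :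
    ∃ D : Submodule ℝ X, ClosedCofinite D ∧ ∀ y ∈ K, ∀ e ∈ D, R y e := by
  refine hK.induction_on (p := fun s => ∃ D : Submodule ℝ X, ClosedCofinite D ∧
    ∀ y ∈ s, ∀ e ∈ D, R y e) ⟨⊤, .top, by simp⟩ ?_ ?_ ?_
  · rintro s t hst ⟨D, hD, hR⟩
    exact ⟨D, hD, fun y hy => hR y (hst hy)⟩
  · rintro s t ⟨D, hD, hR⟩ ⟨D', hD', hR'⟩
    refine ⟨D ⊓ D', hD.inf hD', ?_⟩
    rintro y (hy | hy) e he
    · exact hR y hy e he.1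
    · exact hR' y hy e he.2
  · intro y hy
    obtain ⟨D, hD, hR⟩ := h y hy
    exact ⟨_, hR, D, hD, fun y' hy' => hy'⟩

lemma isCompact_inter_of_finiteDimensional (F : Submodule ℝ X) [FiniteDimensional ℝ F] {s : Set X}
    (hs : IsClosed s) (hb : Bornology.IsBounded s) : IsCompact ((F : Set X) ∩ s) := by
  have h1 : IsCompact ((↑) ⁻¹' s : Set F) := by
    have := FiniteDimensional.proper_real F
    refine Metric.isCompact_of_isClosed_isBounded (hs.preimage continuous_subtype_val) ?_
    obtain ⟨C, hC⟩ := hb.exists_norm_le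
    exact isBounded_iff_forall_norm_le.2 ⟨C, fun x hx => hC _ hx⟩
  have h2 := h1.image continuous_subtype_val
  exact (Subtype.image_preimage_coe (F : Set X) s) ▸ h2

/-- Mazur's lemma: a finite dimensional subspace is almost orthogonal to a subspace of finite
codimension. -/
lemma exists_closedCofinite_norm_le (F : Submodule ℝ X) [FiniteDimensional ℝ F] :
    ∃ D : Submodule ℝ X, ClosedCofinite D ∧ ∀ y ∈ F, ∀ e ∈ D, ‖y‖ ≤ 2 * ‖y + e‖ := by
  obtain ⟨D, hD, h⟩ := (isCompact_inter_of_finiteDimensional F (isClosed_sphere (x := (0 : X))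
    (ε := 1)) isBounded_sphere).exists_closedCofinite (fun y e => 1 / 2 ≤ ‖y + e‖) (by
      rintro y ⟨-, hy⟩
      have hy1 : ‖y‖ = 1 := by simpa using hy
      obtain ⟨f, hf, hfy⟩ := exists_dual_vector ℝ y (by simp [hy1])
      refine ⟨f.ker, .ker f, ?_⟩
      have hc : Tendsto f (𝓝[(F : Set X) ∩ sphere 0 1] y) (𝓝 (f y)) :=
        f.continuous.continuousWithinAt
      rw [hfy, hy1] at hc
      filter_upwards [hc.eventually_const_lt (u := 1 / 2) (by norm_num)] with y' hy' e he
      have he' : f e = 0 := he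
      calc (1 / 2 : ℝ) ≤ f (y' + e) := by rw [map_add, he', add_zero]; exact hy'.le
        _ ≤ ‖f (y' + e)‖ := le_abs_self _
        _ ≤ ‖f‖ * ‖y' + e‖ := f.le_opNorm _
        _ = ‖y' + e‖ := by rw [hf, one_mul])
  refine ⟨D, hD, fun y hy e he => ?_⟩
  rcases eq_or_ne y 0 with rfl | hy0
  · simp
  have hn : 0 < ‖y‖ := norm_pos_iff.2 hy0
  have := h (‖y‖⁻¹ • y) ⟨F.smul_mem _ hy, by simp [norm_smul, hn.ne']⟩ (‖y‖⁻¹ • e)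
    (D.smul_mem _ he)
  rw [← smul_add, norm_smul, norm_inv, norm_norm, inv_mul_eq_div, le_div_iff₀ hn] at this
  linarith

/-- If `D` is closed of finite codimension, some finite dimensional subspace meets all the cosets
of `D`, with norm control. -/
lemma ClosedCofinite.exists_complement {D : Submodule ℝ X} (hD : ClosedCofinite D) :
    ∃ G : Submodule ℝ X, FiniteDimensional ℝ G ∧ ∀ x, ∃ y ∈ G, x - y ∈ D ∧ ‖y‖ ≤ 2 * ‖x‖ := by
  have hcl := hD.1
  have hfd := hD.2
  have := FiniteDimensional.proper_real (X ⧸ D)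
  obtain ⟨s, hs⟩ := D.mkQL.exists_rightInverse_of_surjective
    (LinearMap.range_eq_top.2 D.mkQ_surjective)
  have hs' : ∀ q, (Submodule.Quotient.mk (s q) : X ⧸ D) = q := fun q => DFunLike.congr_fun hs q
  obtain ⟨G, hG, h⟩ : ∃ G : Submodule ℝ X, FiniteDimensional ℝ G ∧
      ∀ q ∈ closedBall (0 : X ⧸ D) 1, ∃ y ∈ G, Submodule.Quotient.mk y = q ∧ ‖y‖ ≤ 2 := by
    refine (isCompact_closedBall (0 : X ⧸ D) 1).induction_on (p := fun t => ∃ G : Submodule ℝ X,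
      FiniteDimensional ℝ G ∧ ∀ q ∈ t, ∃ y ∈ G, Submodule.Quotient.mk y = q ∧ ‖y‖ ≤ 2)
      ⟨⊥, inferInstance, by simp⟩ ?_ ?_ ?_
    · rintro t t' ht ⟨G, hG, h⟩
      exact ⟨G, hG, fun q hq => h q (ht hq)⟩
    · rintro t t' ⟨G, hG, h⟩ ⟨G', hG', h'⟩
      refine ⟨G ⊔ G', inferInstance, ?_⟩
      rintro q (hq | hq)
      · obtain ⟨y, hy, h2⟩ := h q hq
        exact ⟨y, (le_sup_left : G ≤ G ⊔ G') hy, h2⟩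
      · obtain ⟨y, hy, h2⟩ := h' q hq
        exact ⟨y, (le_sup_right : G' ≤ G ⊔ G') hy, h2⟩
    · intro q hq
      obtain ⟨y, hy, hyn⟩ := Submodule.Quotient.norm_mk_lt q (ε := 1 / 2) (by norm_num)
      have hc : Tendsto (fun q' => ‖s (q' - q)‖) (𝓝[closedBall 0 1] q) (𝓝 ‖s (q - q)‖) :=
        (by fun_prop : Continuous fun q' => ‖s (q' - q)‖).continuousWithinAt
      rw [sub_self, map_zero, norm_zero] at hc
      refine ⟨_, hc.eventually_lt_const (u := 1 / 2) (by norm_num),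
        (ℝ ∙ y) ⊔ LinearMap.range (s : (X ⧸ D) →ₗ[ℝ] X), inferInstance, ?_⟩
      intro q' hq'
      refine ⟨y + s (q' - q), Submodule.add_mem_sup (Submodule.mem_span_singleton_self y)
        ⟨_, rfl⟩, ?_, ?_⟩
      · rw [Submodule.Quotient.mk_add, hy, hs', add_sub_cancel]
      · have h1 : ‖q‖ ≤ 1 := by simpa using hq
        have h2 : ‖s (q' - q)‖ < 1 / 2 := hq'
        linarith [norm_add_le y (s (q' - q))]
  refine ⟨G, hG, fun x => ?_⟩
  rcases eq_or_ne x 0 with rfl | hx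
  · exact ⟨0, G.zero_mem, by simp, by simp⟩
  have hn : 0 < ‖x‖ := norm_pos_iff.2 hx
  obtain ⟨y, hy, hq, hyn⟩ := h (Submodule.Quotient.mk (‖x‖⁻¹ • x)) (by
    rw [mem_closedBall, dist_zero_right]
    refine (Submodule.Quotient.norm_mk_le D _).trans ?_
    simp [norm_smul, hn.ne'])
  refine ⟨‖x‖ • y, G.smul_mem _ hy, ?_, ?_⟩
  · rw [← Submodule.Quotient.eq, Submodule.Quotient.mk_smul, hq, ← Submodule.Quotient.mk_smul,
      smul_inv_smul₀ hn.ne']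
  · rw [norm_smul, norm_norm, mul_comm]
    gcongr

end Cofinite

section AUF

variable {X : Type*} [NormedAddCommGroup X] [NormedSpace ℝ X] {N : X → ℝ}

lemma IsNormFn.zero (hN : IsNormFn X N) : N 0 = 0 := (hN.2.1 0).2 rfl

lemma IsNormFn.smul (hN : IsNormFn X N) {c : ℝ} (hc : 0 ≤ c) (x : X) : N (c • x) = c * N x := by
  rw [hN.2.2.1, abs_of_nonneg hc]

/-- For an AUF norm, every ball point admits small perturbations, along a closed subspace of finite
codimension, which increase the norm by arbitrarily little. -/
lemma IsAUFNorm.exists_closedCofinite (hN : IsNormFn X N) (h : IsAUFNorm X N) :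
    ∃ τ : ℝ, 0 < τ ∧ τ ≤ 1 ∧ ∀ y, N y ≤ 1 → ∀ ε > 0, ∃ D : Submodule ℝ X, ClosedCofinite D ∧
      ∀ e ∈ D, N e ≤ τ → N (y + e) ≤ 1 + ε := by
  obtain ⟨τ₀, h0, hρ⟩ := h
  refine ⟨min τ₀ 1, by positivity, min_le_right _ _, fun y hy ε hε => ?_⟩
  by_cases hfin : FiniteDimensional ℝ X
  · refine ⟨⊥, ⟨Submodule.closed_of_finiteDimensional _, inferInstance⟩, fun e he _ => ?_⟩
    rw [(Submodule.mem_bot ℝ).1 he, add_zero]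
    linarith
  have key : ∀ z x : X, N z ≤ 1 → N x ≤ 1 → N (z + τ₀ • x) - 1 ≤ τ₀ := by
    intro z x hz hx
    have := hN.2.2.2 z (τ₀ • x)
    rw [hN.smul h0.le] at this
    nlinarith
  have lower : ∀ z, N z ≤ 1 → ∀ E : Submodule ℝ X,
      -1 ≤ sSup { t : ℝ | ∃ x ∈ E, N x ≤ 1 ∧ t = N (z + τ₀ • x) - 1 } := by
    intro z hz E
    refine le_trans ?_ (le_csSup ⟨τ₀, ?_⟩ ⟨0, E.zero_mem, by simp [hN.zero], rfl⟩)
    · linarith [hN.1 (z + τ₀ • (0 : X))]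
    · rintro _ ⟨x, -, hx, rfl⟩
      exact key z x hz hx
  simp only [rhoN, if_neg hfin] at hρ
  have hinf : sInf { s : ℝ | ∃ E : Submodule ℝ X, IsClosed (E : Set X) ∧
      FiniteDimensional ℝ (X ⧸ E) ∧
      s = sSup { t : ℝ | ∃ x ∈ E, N x ≤ 1 ∧ t = N (y + τ₀ • x) - 1 } } ≤ 0 := by
    rw [← hρ]
    refine le_csSup ⟨τ₀, ?_⟩ ⟨y, hy, rfl⟩
    rintro _ ⟨z, hz, rfl⟩
    refine (csInf_le ⟨-1, ?_⟩ (by exact ⟨⊤, isClosed_univ, inferInstance, rfl⟩)).trans ?_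
    · rintro _ ⟨E, -, -, rfl⟩
      exact lower z hz E
    · refine Real.sSup_le ?_ h0.le
      rintro _ ⟨x, -, hx, rfl⟩
      exact key z x hz hx
  obtain ⟨_, ⟨E, hE, hE', rfl⟩, hlt⟩ := exists_lt_of_csInf_lt
    (by exact ⟨_, ⊤, isClosed_univ, inferInstance, rfl⟩) (hinf.trans_lt hε)
  refine ⟨E, ⟨hE, hE'⟩, fun e he hn => ?_⟩
  have hmem : N (y + τ₀ • (τ₀⁻¹ • e)) - 1 ∈
      { t : ℝ | ∃ x ∈ E, N x ≤ 1 ∧ t = N (y + τ₀ • x) - 1 } := by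
    refine ⟨_, E.smul_mem _ he, ?_, rfl⟩
    rw [hN.smul (inv_nonneg.2 h0.le), inv_mul_le_iff₀ h0, mul_one]
    exact hn.trans (min_le_left _ _)
  have := (le_csSup ⟨τ₀, by rintro _ ⟨x, -, hx, rfl⟩; exact key y x hy hx⟩ hmem).trans_lt hlt
  rw [smul_inv_smul₀ h0.ne'] at this
  linarith

lemma IsNormFn.abs_sub_le (hN : IsNormFn X N) (x y : X) : |N x - N y| ≤ N (x - y) := by
  have h1 := hN.2.2.2 (x - y) y
  have h2 := hN.2.2.2 (y - x) x
  have h3 := hN.2.2.1 (-1) (x - y)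
  rw [sub_add_cancel] at h1 h2
  rw [neg_one_smul, neg_sub, abs_neg, abs_one, one_mul] at h3
  rw [abs_le]
  constructor <;> linarith

lemma IsEquivNorm.continuous (hN : IsEquivNorm X N) : Continuous N := by
  obtain ⟨hN, a, ha, b, hb, hab⟩ := hN
  refine continuous_iff_continuousAt.2 fun x => ?_
  refine tendsto_iff_dist_tendsto_zero.2 (squeeze_zero (fun _ => dist_nonneg)
    (g := fun y => b * ‖y - x‖) (fun y => (hN.abs_sub_le y x).trans (hab _).2) ?_)
  have : Continuous fun y => b * ‖y - x‖ := by fun_prop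
  simpa using this.tendsto x

lemma IsEquivNorm.exists_closedCofinite (hN : IsEquivNorm X N) {τ : ℝ}
    (h : ∀ y, N y ≤ 1 → ∀ ε > 0, ∃ D : Submodule ℝ X, ClosedCofinite D ∧
      ∀ e ∈ D, N e ≤ τ → N (y + e) ≤ 1 + ε)
    (F : Submodule ℝ X) [FiniteDimensional ℝ F] {α β : ℝ} (hα : 1 ≤ α) (hβ : α < β) :
    ∃ D : Submodule ℝ X, ClosedCofinite D ∧
      ∀ y ∈ F, N y ≤ α → ∀ e ∈ D, N e ≤ τ → N (y + e) ≤ β := by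
  have hc := hN.continuous
  obtain ⟨hN, a, ha, b, hb, hab⟩ := hN
  have hα0 : 0 < α := by linarith
  have hK : IsCompact ((F : Set X) ∩ {y | N y ≤ α}) := by
    refine isCompact_inter_of_finiteDimensional F (isClosed_le hc continuous_const) ?_
    refine isBounded_iff_forall_norm_le.2 ⟨α / a, fun x hx => ?_⟩
    rw [le_div_iff₀ ha, mul_comm]
    exact (hab x).1.trans hx
  obtain ⟨D, hD, hR⟩ := hK.exists_closedCofinite (fun y e => N e ≤ τ → N (y + e) ≤ β) (by
    rintro y ⟨-, hy⟩
    have hy' : N (α⁻¹ • y) ≤ 1 := by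
      rw [hN.smul (by positivity), inv_mul_le_iff₀ hα0, mul_one]; exact hy
    obtain ⟨D, hD, hR⟩ := h (α⁻¹ • y) hy' ((β - α) / (2 * α)) (by
      have : 0 < β - α := by linarith
      positivity)
    refine ⟨D, hD, ?_⟩
    have hc' : Tendsto (fun y' => N (y' - y)) (𝓝[(F : Set X) ∩ {y | N y ≤ α}] y)
        (𝓝 (N (y - y))) :=
      (hc.comp (continuous_id.sub continuous_const)).continuousWithinAt
    rw [sub_self, hN.zero] at hc'
    filter_upwards [hc'.eventually_lt_const (u := (β - α) / 2) (by linarith)] with y' hy' e he hn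
    have h1 := hR (α⁻¹ • e) (D.smul_mem _ he) (by
      rw [hN.smul (by positivity), inv_mul_le_iff₀ hα0]
      nlinarith [hN.1 e])
    rw [← smul_add, hN.smul (by positivity), inv_mul_le_iff₀ hα0] at h1
    have h2 : α * (1 + (β - α) / (2 * α)) = α + (β - α) / 2 := by field_simp
    have h3 := hN.2.2.2 (y' - y) (y + e)
    rw [← add_assoc, sub_add_cancel] at h3
    linarith)
  exact ⟨D, hD, fun y hy hn e he => hR y ⟨hy, hn⟩ e he⟩

end AUF

section Decomposition

/-- Increasing finite dimensional subspaces `F j` and decreasing closed subspaces `D j` of finite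
codimension, such that sums of vectors of the blocks `F (j + 1) ⊓ D j` satisfy an upper `c₀`
estimate and such that `F j + D j` is the whole space, while `F j` and `D (j + 1)` are almost
orthogonal. -/
structure FlatDecomposition (X : Type*) [NormedAddCommGroup X] [NormedSpace ℝ X] where
  F : ℕ → Submodule ℝ X
  D : ℕ → Submodule ℝ X
  C : ℝ
  C_pos : 0 < C
  finiteDimensional : ∀ j, FiniteDimensional ℝ (F j)
  closedCofinite : ∀ j, ClosedCofinite (D j)
  monotone : Monotone F
  antitone : Antitone D
  F_zero : F 0 = ⊥
  dense : ∀ x : X, x ∈ closure (⋃ j, (F j : Set X))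
  split : ∀ j x, ∃ y ∈ F j, x - y ∈ D j ∧ ‖y‖ ≤ 2 * ‖x‖
  ortho : ∀ j, ∀ y ∈ F j, ∀ e ∈ D (j + 1), ‖y‖ ≤ 2 * ‖y + e‖
  norm_sum_le : ∀ (d : ℕ → X) (M : ℝ), (∀ j, d j ∈ F (j + 1)) → (∀ j, d j ∈ D j) →
    (∀ j, ‖d j‖ ≤ M) → ∀ n, ‖∑ j ∈ Finset.range n, d j‖ ≤ C * M

variable {X : Type*} [NormedAddCommGroup X] [NormedSpace ℝ X] {N : X → ℝ}

lemma IsNormFn.sum_le_of_gaps (hN : IsNormFn X N) {F D : ℕ → Submodule ℝ X} (hF : Monotone F)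
    {α : ℕ → ℝ} {τ : ℝ} (hα : Monotone α) (hα0 : 0 ≤ α 0) (hτ : τ ≤ α 0)
    (h : ∀ j, ∀ y ∈ F j, N y ≤ α j → ∀ e ∈ D (j + 1), N e ≤ τ → N (y + e) ≤ α (j + 1))
    {d : ℕ → X} (hdF : ∀ j, d j ∈ F (j + 1)) (hdD : ∀ j, d j ∈ D j) (hd : ∀ j, N (d j) ≤ τ)
    (hgap : ∀ j, d j = 0 ∨ d (j + 1) = 0) (n : ℕ) : N (∑ j ∈ Finset.range n, d j) ≤ α n := by
  have hsum : ∀ n, ∑ j ∈ Finset.range n, d j ∈ F n := fun n =>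
    Submodule.sum_mem _ fun j hj => hF (Finset.mem_range.1 hj) (hdF j)
  induction n using Nat.strong_induction_on with
  | _ n ih =>
    match n with
    | 0 => simpa [hN.zero] using hα0
    | 1 => simpa using (hd 0).trans (hτ.trans (hα zero_le_one))
    | n + 2 =>
      rw [Finset.sum_range_succ]
      rcases hgap n with h0 | h0
      · rw [Finset.sum_range_succ, h0, add_zero]
        exact (h n _ (hsum n) (ih n (by lia)) _ (hdD _) (hd _)).trans (hα (by lia))
      · rw [h0, add_zero]
        exact (ih (n + 1) (by lia)).trans (hα (by lia))

lemma IsEquivNorm.exists_norm_sum_le (hN : IsEquivNorm X N) {F D : ℕ → Submodule ℝ X}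
    (hF : Monotone F) {α : ℕ → ℝ} {τ : ℝ} (hα : Monotone α) (hα2 : ∀ n, α n ≤ 2) (hα0 : 0 ≤ α 0)
    (hτ0 : 0 < τ) (hτ : τ ≤ α 0)
    (h : ∀ j, ∀ y ∈ F j, N y ≤ α j → ∀ e ∈ D (j + 1), N e ≤ τ → N (y + e) ≤ α (j + 1)) :
    ∃ C > 0, ∀ (d : ℕ → X) (M : ℝ), (∀ j, d j ∈ F (j + 1)) → (∀ j, d j ∈ D j) →
      (∀ j, ‖d j‖ ≤ M) → ∀ n, ‖∑ j ∈ Finset.range n, d j‖ ≤ C * M := by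
  obtain ⟨hN, a, ha, b, hb, hab⟩ := hN
  have unit : ∀ d : ℕ → X, (∀ j, d j ∈ F (j + 1)) → (∀ j, d j ∈ D j) → (∀ j, N (d j) ≤ τ) →
      ∀ n, N (∑ j ∈ Finset.range n, d j) ≤ 4 := by
    intro d hdF hdD hd n
    have part : ∀ P : ℕ → Prop, ∀ _ : DecidablePred P, (∀ j, P j → ¬ P (j + 1)) →
        N (∑ j ∈ Finset.range n, if P j then d j else 0) ≤ 2 := by
      intro P _ hP
      refine (hN.sum_le_of_gaps hF hα hα0 hτ h (d := fun j => if P j then d j else 0)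
        ?_ ?_ ?_ ?_ n).trans (hα2 n)
      · intro j; split_ifs
        exacts [hdF j, Submodule.zero_mem _]
      · intro j; split_ifs
        exacts [hdD j, Submodule.zero_mem _]
      · intro j; split_ifs
        exacts [hd j, by simpa [hN.zero] using hτ0.le]
      · intro j
        by_cases hj : P j
        · exact Or.inr (if_neg (hP j hj))
        · exact Or.inl (if_neg hj)
    have h1 := part (fun j => Even j) inferInstance (fun j hj => by simpa [Nat.even_add_one] using hj)
    have h2 := part (fun j => ¬ Even j) inferInstance
      (fun j hj => by simpa [Nat.even_add_one] using hj)
    have h3 : ∑ j ∈ Finset.range n, d j = (∑ j ∈ Finset.range n, if Even j then d j else 0) +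
        ∑ j ∈ Finset.range n, if ¬ Even j then d j else 0 := by
      rw [← Finset.sum_add_distrib]
      refine Finset.sum_congr rfl fun j _ => ?_
      by_cases hj : Even j <;> simp [hj]
    rw [h3]
    linarith [hN.2.2.2 (∑ j ∈ Finset.range n, if Even j then d j else 0)
      (∑ j ∈ Finset.range n, if ¬ Even j then d j else 0)]
  refine ⟨4 * b / (a * τ), by positivity, fun d M hdF hdD hd n => ?_⟩
  rcases ((norm_nonneg _).trans (hd 0)).eq_or_lt with hM | hM
  · have : ∀ j, d j = 0 := fun j => norm_le_zero_iff.1 ((hd j).trans hM.ge)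
    simp [this, ← hM]
  have h1 := unit (fun j => (τ / (b * M)) • d j) (fun j => Submodule.smul_mem _ _ (hdF j))
    (fun j => Submodule.smul_mem _ _ (hdD j)) (fun j => by
      rw [hN.smul (by positivity), div_mul_eq_mul_div, div_le_iff₀ (by positivity)]
      exact mul_le_mul_of_nonneg_left
        ((hab _).2.trans (mul_le_mul_of_nonneg_left (hd j) hb.le)) hτ0.le) n
  rw [← Finset.smul_sum, hN.smul (by positivity), div_mul_eq_mul_div,
    div_le_iff₀ (by positivity)] at h1
  rw [div_mul_eq_mul_div, le_div_iff₀ (by positivity)]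
  calc _ = τ * (a * ‖∑ j ∈ Finset.range n, d j‖) := by ring
    _ ≤ τ * N (∑ j ∈ Finset.range n, d j) := by gcongr; exact (hab _).1
    _ ≤ 4 * (b * M) := h1
    _ = _ := by ring

lemma AUFable.nonempty_flatDecomposition [TopologicalSpace.SeparableSpace X] (h : AUFable X) :
    Nonempty (FlatDecomposition X) := by
  obtain ⟨N, hN, hA⟩ := h
  obtain ⟨τ, hτ0, hτ1, hτ⟩ := hA.exists_closedCofinite hN.1
  let α : ℕ → ℝ := fun n => 2 - (1 / 2) ^ n
  have hα : StrictMono α := fun m n hmn =>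
    sub_lt_sub_left (pow_lt_pow_right_of_lt_one₀ (by norm_num) (by norm_num) hmn) _
  have hα0 : α 0 = 1 := by norm_num [α]
  have hα1 : ∀ n, 1 ≤ α n := fun n => hα0 ▸ hα.monotone (Nat.zero_le n)
  let S := { p : Submodule ℝ X × Submodule ℝ X // FiniteDimensional ℝ p.1 ∧ ClosedCofinite p.2 ∧
    ∀ x, ∃ y ∈ p.1, x - y ∈ p.2 ∧ ‖y‖ ≤ 2 * ‖x‖ }
  let R : ℕ → S → S → Prop := fun j p q => p.1.1 ≤ q.1.1 ∧ q.1.2 ≤ p.1.2 ∧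
    TopologicalSpace.denseSeq X j ∈ q.1.1 ∧ (∀ y ∈ p.1.1, ∀ e ∈ q.1.2, ‖y‖ ≤ 2 * ‖y + e‖) ∧
    ∀ y ∈ p.1.1, N y ≤ α j → ∀ e ∈ q.1.2, N e ≤ τ → N (y + e) ≤ α (j + 1)
  have step : ∀ j p, ∃ q, R j p q := by
    rintro j ⟨⟨F, D⟩, hF, hD, -⟩
    dsimp only at hF hD
    obtain ⟨D₁, hD₁, h₁⟩ := exists_closedCofinite_norm_le F
    obtain ⟨D₂, hD₂, h₂⟩ := hN.exists_closedCofinite hτ F (hα1 j) (hα (Nat.lt_succ_self j))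
    have hD' := hD.inf (hD₁.inf hD₂)
    obtain ⟨G, hG, hs⟩ := hD'.exists_complement
    refine ⟨⟨⟨F ⊔ ((ℝ ∙ TopologicalSpace.denseSeq X j) ⊔ G), D ⊓ (D₁ ⊓ D₂)⟩, ?_, hD', ?_⟩,
      le_sup_left, inf_le_left, ?_, ?_, ?_⟩
    · dsimp only
      infer_instance
    · intro x
      obtain ⟨y, hy, h⟩ := hs x
      exact ⟨y, (le_sup_right.trans le_sup_right :
        G ≤ F ⊔ ((ℝ ∙ TopologicalSpace.denseSeq X j) ⊔ G)) hy, h⟩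
    · exact (le_sup_left.trans le_sup_right : (ℝ ∙ TopologicalSpace.denseSeq X j) ≤
        F ⊔ ((ℝ ∙ TopologicalSpace.denseSeq X j) ⊔ G)) (Submodule.mem_span_singleton_self _)
    · exact fun y hy e he => h₁ y hy e he.2.1
    · exact fun y hy hn e he => h₂ y hy hn e he.2.2
  choose f hf using step
  let p₀ : S := ⟨⟨⊥, ⊤⟩, inferInstanceAs (FiniteDimensional ℝ (⊥ : Submodule ℝ X)), .top,
    fun x => ⟨0, Submodule.zero_mem _, Submodule.mem_top, by simp⟩⟩
  let p : ℕ → S := fun n => Nat.rec p₀ f n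
  have hp : ∀ n, R n (p n) (p (n + 1)) := fun n => hf n (p n)
  have hF : Monotone fun n => (p n).1.1 := monotone_nat_of_le_succ fun n => (hp n).1
  obtain ⟨C, hC, hsum⟩ := hN.exists_norm_sum_le (D := fun n => (p n).1.2) hF hα.monotone
    (fun n => by simp only [α]; linarith [pow_pos (by norm_num : (0 : ℝ) < 1 / 2) n])
    (by rw [hα0]; exact zero_le_one) hτ0 (by rw [hα0]; exact hτ1) (fun j => (hp j).2.2.2.2)
  exact ⟨{
    F := fun n => (p n).1.1
    D := fun n => (p n).1.2
    C := C
    C_pos := hC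
    finiteDimensional := fun j => (p j).2.1
    closedCofinite := fun j => (p j).2.2.1
    monotone := hF
    antitone := antitone_nat_of_succ_le fun n => (hp n).2.1
    F_zero := rfl
    dense := fun x => closure_mono (by
      rintro _ ⟨j, rfl⟩
      exact mem_iUnion.2 ⟨j + 1, (hp j).2.2.1⟩) (TopologicalSpace.denseRange_denseSeq X x)
    split := fun j => (p j).2.2.2
    ortho := fun j => (hp j).2.2.2.1
    norm_sum_le := hsum }⟩

end Decomposition

section FiniteDimensional

/-- The dual ball of a finite dimensional space contains a finite `1/2`-norming family. -/
lemma exists_finite_norming_family (H : Type*) [NormedAddCommGroup H] [NormedSpace ℝ H]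
    [FiniteDimensional ℝ H] :
    ∃ (n : ℕ) (f : Fin n → H →L[ℝ] ℝ), (∀ i, ‖f i‖ ≤ 1) ∧ ∀ h ≠ 0, ∃ i, ‖h‖ ≤ 2 * |f i h| := by
  have := FiniteDimensional.proper_real H
  obtain ⟨n, f, hf, h⟩ : ∃ (n : ℕ) (f : Fin n → H →L[ℝ] ℝ), (∀ i, ‖f i‖ ≤ 1) ∧
      ∀ h ∈ sphere (0 : H) 1, ∃ i, 1 / 2 ≤ |f i h| := by
    refine (isCompact_sphere (0 : H) 1).induction_on (p := fun s => ∃ (n : ℕ)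
      (f : Fin n → H →L[ℝ] ℝ), (∀ i, ‖f i‖ ≤ 1) ∧ ∀ h ∈ s, ∃ i, 1 / 2 ≤ |f i h|)
      ⟨0, Fin.elim0, fun i => i.elim0, by simp⟩ ?_ ?_ ?_
    · rintro s t hst ⟨n, f, hf, h⟩
      exact ⟨n, f, hf, fun x hx => h x (hst hx)⟩
    · rintro s t ⟨n, f, hf, h⟩ ⟨m, g, hg, h'⟩
      refine ⟨n + m, Fin.append f g, fun i => ?_, ?_⟩
      · refine Fin.addCases (fun i => ?_) (fun i => ?_) i
        · simpa using hf i
        · simpa using hg i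
      · rintro x (hx | hx)
        · obtain ⟨i, hi⟩ := h x hx
          exact ⟨Fin.castAdd m i, by simpa using hi⟩
        · obtain ⟨i, hi⟩ := h' x hx
          exact ⟨Fin.natAdd n i, by simpa using hi⟩
    · intro x hx
      have hx1 : ‖x‖ = 1 := by simpa using hx
      obtain ⟨f, hf, hfx⟩ := exists_dual_vector ℝ x (by simp [hx1])
      have hc : Tendsto f (𝓝[sphere 0 1] x) (𝓝 (f x)) := f.continuous.continuousWithinAt
      rw [hfx, hx1] at hc
      refine ⟨_, hc.eventually_const_lt (u := 1 / 2) (by norm_num), 1, fun _ => f,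
        fun _ => hf.le, fun x' hx' => ⟨0, ?_⟩⟩
      exact (le_of_lt hx').trans (le_abs_self _)
  refine ⟨n, f, hf, fun x hx => ?_⟩
  have hn : 0 < ‖x‖ := norm_pos_iff.2 hx
  obtain ⟨i, hi⟩ := h (‖x‖⁻¹ • x) (by simp [norm_smul, hn.ne'])
  refine ⟨i, ?_⟩
  rw [map_smul, smul_eq_mul, abs_mul, abs_inv, abs_norm, inv_mul_eq_div, le_div_iff₀ hn] at hi
  linarith

/-- A finite dimensional space is, up to the constant `2`, a quotient of some `ℓ₁ⁿ`. -/
lemma exists_finite_spanning_family (H : Type*) [NormedAddCommGroup H] [NormedSpace ℝ H]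
    [FiniteDimensional ℝ H] :
    ∃ (n : ℕ) (v : Fin (n + 1) → H), (∀ i, ‖v i‖ ≤ 1) ∧
      ∀ h, ∃ c : Fin (n + 1) → ℝ, ∑ i, |c i| ≤ 2 * ‖h‖ ∧ ∑ i, c i • v i = h := by
  have := FiniteDimensional.proper_real H
  obtain ⟨n, v, hv, h⟩ : ∃ (n : ℕ) (v : Fin (n + 1) → H), (∀ i, ‖v i‖ ≤ 1) ∧
      ∀ h ∈ closedBall (0 : H) 1, ∃ c : Fin (n + 1) → ℝ, ∑ i, |c i| ≤ 2 ∧ ∑ i, c i • v i = h := by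
    refine (isCompact_closedBall (0 : H) 1).induction_on (p := fun s => ∃ (n : ℕ)
      (v : Fin (n + 1) → H), (∀ i, ‖v i‖ ≤ 1) ∧
      ∀ h ∈ s, ∃ c : Fin (n + 1) → ℝ, ∑ i, |c i| ≤ 2 ∧ ∑ i, c i • v i = h)
      ⟨0, 0, by simp, by simp⟩ ?_ ?_ ?_
    · rintro s t hst ⟨n, v, hv, h⟩
      exact ⟨n, v, hv, fun x hx => h x (hst hx)⟩
    · rintro s t ⟨n, v, hv, h⟩ ⟨m, w, hw, h'⟩
      refine ⟨n + 1 + m, (Fin.append v w : Fin (n + 1 + (m + 1)) → H), fun i => ?_, ?_⟩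
      · refine Fin.addCases (m := n + 1) (n := m + 1) (fun i => ?_) (fun i => ?_) i
        · simpa using hv i
        · simpa using hw i
      · rintro x (hx | hx)
        · obtain ⟨c, hc, hcx⟩ := h x hx
          refine ⟨(Fin.append c 0 : Fin (n + 1 + (m + 1)) → ℝ), ?_, ?_⟩
          · exact (Fin.sum_univ_add (a := n + 1) (b := m + 1) _).trans_le (by simpa using hc)
          · exact (Fin.sum_univ_add (a := n + 1) (b := m + 1) _).trans (by simpa using hcx)
        · obtain ⟨c, hc, hcx⟩ := h' x hx
          refine ⟨(Fin.append 0 c : Fin (n + 1 + (m + 1)) → ℝ), ?_, ?_⟩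
          · exact (Fin.sum_univ_add (a := n + 1) (b := m + 1) _).trans_le (by simpa using hc)
          · exact (Fin.sum_univ_add (a := n + 1) (b := m + 1) _).trans (by simpa using hcx)
    · intro x hx
      let b := Module.finBasis ℝ H
      have hb : Continuous b.equivFun := continuous_equivFun_basis b
      have hc : Tendsto (fun y => ∑ i, |‖b i‖ * b.equivFun (y - x) i|) (𝓝[closedBall 0 1] x)
          (𝓝 (∑ i, |‖b i‖ * b.equivFun (x - x) i|)) := by
        refine Continuous.continuousWithinAt ?_
        refine continuous_finsetSum _ fun i _ => ?_
        exact (continuous_const.mul ((continuous_apply i).comp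
          (hb.comp (continuous_id.sub continuous_const)))).abs
      rw [sub_self, map_zero] at hc
      simp only [Pi.zero_apply, mul_zero, abs_zero, Finset.sum_const_zero] at hc
      refine ⟨_, hc.eventually_lt_const (u := 1) one_pos, Module.finrank ℝ H,
        Fin.cons x fun i => ‖b i‖⁻¹ • b i, ?_, ?_⟩
      · refine Fin.cases (by simpa using hx) fun i => ?_
        simp [norm_smul, b.ne_zero i]
      · intro y hy
        refine ⟨Fin.cons 1 fun i => ‖b i‖ * b.equivFun (y - x) i, ?_, ?_⟩
        · have hy' : ∑ i, |‖b i‖ * b.equivFun (y - x) i| < 1 := hy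
          simp only [Fin.sum_univ_succ, Fin.cons_zero, Fin.cons_succ, abs_one]
          linarith
        · have : ∀ i, (‖b i‖ * b.equivFun (y - x) i) • ‖b i‖⁻¹ • b i =
              b.equivFun (y - x) i • b i := fun i => by
            rw [smul_smul]
            congr 1
            have : ‖b i‖ ≠ 0 := norm_ne_zero_iff.2 (b.ne_zero i)
            field_simp
          simp only [Fin.sum_univ_succ, Fin.cons_zero, Fin.cons_succ, one_smul, this,
            b.sum_equivFun]
          abel
  refine ⟨n, v, hv, fun x => ?_⟩
  rcases eq_or_ne x 0 with rfl | hx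
  · exact ⟨0, by simp, by simp⟩
  have hn : 0 < ‖x‖ := norm_pos_iff.2 hx
  obtain ⟨c, hc, hcx⟩ := h (‖x‖⁻¹ • x) (by simp [norm_smul, hn.ne'])
  refine ⟨fun i => ‖x‖ * c i, ?_, ?_⟩
  · simp only [abs_mul, abs_norm]
    rw [← Finset.mul_sum, mul_comm]
    gcongr
  · simp only [mul_smul]
    rw [← Finset.smul_sum, hcx, smul_inv_smul₀ hn.ne']

end FiniteDimensional

lemma aufable_of_forall_exists_closedCofinite {X : Type*} [NormedAddCommGroup X] [NormedSpace ℝ X]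
    (h : ∀ y : X, ‖y‖ ≤ 1 → ∀ ε > 0, ∃ D : Submodule ℝ X, ClosedCofinite D ∧
      ∀ e ∈ D, ‖e‖ ≤ 1 → ‖y + e‖ ≤ 1 + ε) : AUFable X := by
  refine ⟨fun f => ‖f‖, ⟨⟨norm_nonneg, fun _ => norm_eq_zero, norm_smul, norm_add_le⟩,
    1, one_pos, 1, one_pos, by simp⟩, 1, one_pos, ?_⟩
  rw [rhoN]
  split_ifs with hfin
  · rfl
  simp only [one_smul]
  have key : ∀ y x : X, ‖y‖ ≤ 1 → ‖x‖ ≤ 1 → ‖y + x‖ - 1 ≤ 1 := by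
    intro y x hy hx
    linarith [norm_add_le y x]
  have lower : ∀ y : X, ‖y‖ ≤ 1 → ∀ E : Submodule ℝ X,
      ‖y‖ - 1 ≤ sSup { t : ℝ | ∃ x ∈ E, ‖x‖ ≤ 1 ∧ t = ‖y + x‖ - 1 } := by
    intro y hy E
    refine le_csSup ⟨1, ?_⟩ ⟨0, E.zero_mem, by simp, by simp⟩
    rintro _ ⟨x, -, hx, rfl⟩
    exact key y x hy hx
  have upper : ∀ y : X, ‖y‖ ≤ 1 →
      sInf { s : ℝ | ∃ E : Submodule ℝ X, IsClosed (E : Set X) ∧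
        FiniteDimensional ℝ (X ⧸ E) ∧
        s = sSup { t : ℝ | ∃ x ∈ E, ‖x‖ ≤ 1 ∧ t = ‖y + x‖ - 1 } } ≤ 0 := by
    intro y hy
    refine le_of_forall_pos_le_add fun ε hε => ?_
    obtain ⟨D, hD, hle⟩ := h y hy ε hε
    refine (csInf_le ⟨‖y‖ - 1, ?_⟩ (by exact ⟨D, hD.1, hD.2, rfl⟩)).trans ?_
    · rintro _ ⟨E, -, -, rfl⟩
      exact lower y hy E
    · refine Real.sSup_le ?_ (by linarith)
      rintro _ ⟨x, hx, hx1, rfl⟩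
      linarith [hle x hx hx1]
  have : Nontrivial X := by
    by_contra h
    rw [not_nontrivial_iff_subsingleton] at h
    exact hfin inferInstance
  obtain ⟨y, hy⟩ := exists_norm_eq X zero_le_one
  refine le_antisymm (Real.sSup_le ?_ le_rfl) ?_
  · rintro _ ⟨y, hy, rfl⟩
    exact upper y hy
  · refine le_trans ?_ (le_csSup ⟨0, ?_⟩ (by exact ⟨y, hy.le, rfl⟩))
    · refine le_csInf (by exact ⟨_, ⊤, isClosed_univ, inferInstance, rfl⟩) ?_
      rintro _ ⟨E, -, -, rfl⟩
      simpa [hy] using lower y hy.le E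
    · rintro _ ⟨y, hy, rfl⟩
      exact upper y hy

section UniversalSpace

/-- The space `ℓ₁ⁿ` with `n = i.2 + 1`. -/
abbrev L1Block (i : ℕ × ℕ) : Type := PiLp 1 fun _ : Fin (i.2 + 1) => ℝ

/-- The finitely supported elements of the `ℓ_∞`-sum of the spaces `L1Block i`. -/
def finitelySupported : Submodule ℝ (lp L1Block ⊤) where
  carrier := {f | {i | f i ≠ 0}.Finite}
  zero_mem' := by simp
  add_mem' {f g} hf hg := (hf.union hg).subset fun i hi => by
    by_contra h
    simp only [mem_union, mem_ofPred_eq, not_or, not_not] at h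
    exact hi (by rw [lp.coeFn_add, Pi.add_apply, h.1, h.2, add_zero])
  smul_mem' c f hf := hf.subset fun i hi h => hi (by rw [lp.coeFn_smul, Pi.smul_apply, h, smul_zero])

/-- The `c₀`-sum of the spaces `L1Block i`. -/
abbrev C0Sum : Type := finitelySupported.topologicalClosure

lemma finitelySupported_le_span : (finitelySupported : Set (lp L1Block ⊤)) ⊆
    Submodule.span ℝ (⋃ i, range (lp.singleContinuousLinearMap ℝ L1Block ⊤ i)) := by
  intro f hf
  have hf' : {i | f i ≠ 0}.Finite := hf
  have : f = ∑ i ∈ hf'.toFinset, lp.singleContinuousLinearMap ℝ L1Block ⊤ i (f i) := by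
    ext1
    funext k
    rw [lp.coeFn_sum, Finset.sum_apply]
    by_cases hk : f k = 0
    · rw [hk, Finset.sum_eq_zero]
      intro i hi
      refine lp.single_apply_ne _ _ _ ?_
      rintro rfl
      exact (hf'.mem_toFinset.1 hi) hk
    · rw [Finset.sum_eq_single k]
      · exact (lp.single_apply_self _ _ _).symm
      · exact fun i _ hi => lp.single_apply_ne _ _ _ hi.symm
      · exact fun h => absurd (hf'.mem_toFinset.2 hk) h
  rw [this]
  exact Submodule.sum_mem _ fun i _ => Submodule.subset_span (mem_iUnion.2 ⟨i, _, rfl⟩)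

instance : CompleteSpace C0Sum :=
  (Submodule.isClosed_topologicalClosure _).completeSpace_coe

lemma C0Sum.separableSpace : TopologicalSpace.SeparableSpace C0Sum := by
  have h : TopologicalSpace.IsSeparable (finitelySupported : Set (lp L1Block ⊤)) :=
    (TopologicalSpace.IsSeparable.iUnion fun i => TopologicalSpace.isSeparable_range
      (lp.singleContinuousLinearMap ℝ L1Block ⊤ i).continuous).span.mono finitelySupported_le_span
  exact h.closure.separableSpace

lemma C0Sum.exists_finite_norm_le (f : C0Sum) {ε : ℝ} (hε : 0 < ε) :
    ∃ t : Finset (ℕ × ℕ), ∀ i ∉ t, ‖f.1 i‖ ≤ ε := by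
  obtain ⟨g, hg, hfg⟩ := Metric.mem_closure_iff.1 f.2 ε hε
  have hg' : {i | g i ≠ 0}.Finite := hg
  refine ⟨hg'.toFinset, fun i hi => ?_⟩
  have h0 : g i = 0 := by simpa using hi
  have h1 := lp.norm_apply_le_norm (by simp) (f.1 - g) i
  rw [lp.coeFn_sub, Pi.sub_apply, h0, sub_zero] at h1
  rw [dist_eq_norm] at hfg
  exact h1.trans hfg.le

lemma C0Sum.norm_le {f : C0Sum} {M : ℝ} (hM : 0 ≤ M) (h : ∀ i, ‖f.1 i‖ ≤ M) : ‖f‖ ≤ M :=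
  lp.norm_le_of_forall_le hM h

/-- Evaluation at an index. -/
noncomputable def C0Sum.eval (i : ℕ × ℕ) : C0Sum →L[ℝ] L1Block i :=
  (lp.evalCLM ℝ L1Block ⊤ i).comp finitelySupported.topologicalClosure.subtypeL

lemma C0Sum.eval_apply (i : ℕ × ℕ) (f : C0Sum) : C0Sum.eval i f = f.1 i := rfl

lemma C0Sum.norm_apply_le (f : C0Sum) (i : ℕ × ℕ) : ‖f.1 i‖ ≤ ‖f‖ :=
  lp.norm_apply_le_norm (by simp) f.1 i

lemma C0Sum.aufable : AUFable C0Sum := by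
  refine aufable_of_forall_exists_closedCofinite fun y hy ε hε => ?_
  obtain ⟨t, ht⟩ := y.exists_finite_norm_le hε
  let T : C0Sum →L[ℝ] ((i : t) → L1Block i) := ContinuousLinearMap.pi fun i => C0Sum.eval i
  refine ⟨_, .ker T, fun x hx hx1 => C0Sum.norm_le (by linarith) fun i => ?_⟩
  change ‖y.1 i + x.1 i‖ ≤ _
  by_cases hi : i ∈ t
  · have hxi : x.1 i = 0 := congr_fun (show T x = 0 from hx) ⟨i, hi⟩
    rw [hxi, add_zero]
    linarith [y.norm_apply_le i]
  · linarith [ht i hi, norm_add_le (y.1 i) (x.1 i), x.norm_apply_le i]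

end UniversalSpace

section Embedding

variable {X : Type*} [NormedAddCommGroup X] [NormedSpace ℝ X]

lemma ClosedCofinite.exists_norming_family {D : Submodule ℝ X} (hD : ClosedCofinite D) :
    ∃ (n : ℕ) (f : ℕ → X →L[ℝ] ℝ), (∀ i x, |f i x| ≤ ‖x‖) ∧ (∀ i, ∀ x ∈ D, f i x = 0) ∧
      (∀ i, n ≤ i → f i = 0) ∧
      ∀ x δ, (∀ i, 2 * |f i x| < δ) → ∃ r, x - r ∈ D ∧ ‖r‖ < δ := by
  have hcl := hD.1
  have hfd := hD.2
  obtain ⟨n, f, hf, h⟩ := exists_finite_norming_family (X ⧸ D)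
  have hle : ∀ i x, |f i (D.mkQL x)| ≤ ‖x‖ := fun i x =>
    calc |f i (D.mkQL x)| ≤ ‖f i‖ * ‖D.mkQL x‖ := (f i).le_opNorm _
      _ ≤ 1 * ‖x‖ := mul_le_mul (hf i) (Submodule.Quotient.norm_mk_le D x) (norm_nonneg _)
          zero_le_one
      _ = ‖x‖ := one_mul _
  refine ⟨n, fun i => if hi : i < n then (f ⟨i, hi⟩).comp D.mkQL else 0, ?_, ?_, ?_, ?_⟩
  · intro i x
    dsimp only
    split_ifs with hi
    · exact hle ⟨i, hi⟩ x
    · simp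
  · intro i x hx
    dsimp only
    split_ifs with hi
    · have : D.mkQL x = 0 := (Submodule.Quotient.mk_eq_zero D).2 hx
      simp [this]
    · rfl
  · intro i hi
    exact dif_neg (not_lt.2 hi)
  · intro x δ hx
    have hlt : ‖(Submodule.Quotient.mk x : X ⧸ D)‖ < δ := by
      by_cases h0 : (Submodule.Quotient.mk x : X ⧸ D) = 0
      · rw [h0, norm_zero]
        exact lt_of_le_of_lt (by positivity) (hx 0)
      · obtain ⟨i, hi⟩ := h _ h0
        have := hx i
        dsimp only at this
        rw [dif_pos i.2] at this
        exact hi.trans_lt this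
    obtain ⟨r, hr, hrn⟩ := Submodule.Quotient.norm_mk_lt (Submodule.Quotient.mk x : X ⧸ D)
      (sub_pos.2 hlt)
    exact ⟨r, (Submodule.Quotient.eq D).1 hr.symm, by linarith⟩

/-- A vector of `⋃ j, F j` which is close to every `F j ⊔ D (j + 2)` has small norm. -/
lemma FlatDecomposition.norm_le_of_forall_close (P : FlatDecomposition X) {J : ℕ} {x : X}
    (hx : x ∈ P.F J) {δ : ℝ} (h : ∀ j, ∃ r, x - r ∈ P.F j ⊔ P.D (j + 2) ∧ ‖r‖ < δ) :
    ‖x‖ ≤ 12 * P.C * δ := by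
  have hδ : 0 ≤ δ := by
    obtain ⟨r, -, hr⟩ := h 0
    exact (norm_nonneg r).trans hr.le
  have hdec : ∀ j, ∃ y ∈ P.F j, ∃ e ∈ P.D (j + 2), ∃ v ∈ P.D j, x = y + e + v ∧ ‖v‖ ≤ 3 * δ ∧
      (x ∈ P.F j → y = x) := by
    intro j
    by_cases hj : x ∈ P.F j
    · exact ⟨x, hj, 0, Submodule.zero_mem _, 0, Submodule.zero_mem _, by simp, by simpa using hδ,
        fun _ => rfl⟩
    obtain ⟨r, hr, hrn⟩ := h j
    obtain ⟨y, hy, e, he, hye⟩ := Submodule.mem_sup.1 hr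
    obtain ⟨u, hu, huD, hun⟩ := P.split j r
    refine ⟨y + u, Submodule.add_mem _ hy hu, e, he, r - u, huD, ?_, ?_, fun h => absurd h hj⟩
    · rw [← sub_add_cancel x r, ← hye]
      abel
    · linarith [norm_sub_le r u]
  choose y hy e he v hv hxy hvn hyx using hdec
  have hd : ∀ j, y (j + 1) - y j = (e j - e (j + 1)) + (v j - v (j + 1)) := by
    intro j
    have h1 := (hxy j).symm.trans (hxy (j + 1))
    rw [← sub_eq_zero] at h1 ⊢
    rw [← neg_eq_zero, ← h1]
    abel
  have key := P.norm_sum_le (fun j => y (j + 1) - y j) (12 * δ)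
    (fun j => Submodule.sub_mem _ (hy (j + 1)) (P.monotone (Nat.le_succ j) (hy j)))
    (fun j => by
      rw [hd]
      exact Submodule.add_mem _ (Submodule.sub_mem _ (P.antitone (by lia) (he j))
        (P.antitone (by lia) (he (j + 1)))) (Submodule.sub_mem _ (hv j)
        (P.antitone (by lia) (hv (j + 1)))))
    (fun j => by
      have h1 := P.ortho (j + 1) (y (j + 1) - y j)
        (Submodule.sub_mem _ (hy (j + 1)) (P.monotone (Nat.le_succ j) (hy j)))
        (-(e j - e (j + 1))) (Submodule.neg_mem _ (Submodule.sub_mem _ (he j)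
          (P.antitone (by lia) (he (j + 1)))))
      rw [← sub_eq_add_neg (y (j + 1) - y j), sub_eq_iff_eq_add'.2 (hd j)] at h1
      linarith [norm_sub_le (v j) (v (j + 1)), hvn j, hvn (j + 1)]) J
  have hy0 : y 0 = 0 := by
    have := hy 0
    rwa [P.F_zero, Submodule.mem_bot] at this
  rw [Finset.sum_range_sub, hy0, sub_zero, hyx J hx] at key
  linarith

lemma FlatDecomposition.isomToClosedSubspace (P : FlatDecomposition X) :
    IsomToClosedSubspace X C0Sum := by
  have hcof : ∀ j, ClosedCofinite (P.F j ⊔ P.D (j + 2)) := fun j =>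
    (P.closedCofinite (j + 2)).mono le_sup_right
  choose n f hf hfD hfn hfr using fun j => (hcof j).exists_norming_family
  let g : X → (i : ℕ × ℕ) → L1Block i := fun x i =>
    WithLp.toLp 1 (Pi.single 0 (f i.1 i.2 x))
  have hg : ∀ x i, ‖g x i‖ = |f i.1 i.2 x| := by
    intro x i
    rw [PiLp.norm_eq_of_L1, Finset.sum_eq_single 0]
    · simp [g]
    · intro b _ hb
      simp [g, hb]
    · simp
  have hgadd : ∀ x y, g (x + y) = g x + g y := by
    intro x y
    funext i
    simp only [g, map_add, Pi.single_add, WithLp.toLp_add, Pi.add_apply]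
  have hgsmul : ∀ (c : ℝ) x, g (c • x) = c • g x := by
    intro c x
    funext i
    simp only [g, map_smul, Pi.single_smul, WithLp.toLp_smul, Pi.smul_apply]
  let T : X →L[ℝ] lp L1Block ⊤ := LinearMap.mkContinuous
    { toFun := fun x => ⟨g x, memℓp_infty ⟨‖x‖, by
        rintro _ ⟨i, rfl⟩
        exact (hg x i).trans_le (hf _ _ _)⟩⟩
      map_add' := fun x y => Subtype.ext (hgadd x y)
      map_smul' := fun c x => Subtype.ext (hgsmul c x) } 1 (fun x => by
      rw [one_mul]
      exact lp.norm_le_of_forall_le (norm_nonneg _) fun i => (hg x i).trans_le (hf _ _ _))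
  have hTi : ∀ x j i, |f j i x| ≤ ‖T x‖ := fun x j i =>
    (hg x (j, i)).symm.trans_le (lp.norm_apply_le_norm (by simp) (T x) (j, i))
  have hTmem : ∀ x, T x ∈ finitelySupported.topologicalClosure := by
    intro x
    refine map_mem_closure T.continuous (P.dense x) ?_
    rintro x hx
    obtain ⟨J, hJ⟩ := mem_iUnion.1 hx
    refine ((Set.finite_Iio J).biUnion fun j _ =>
      (Set.finite_Iio (n j)).image (Prod.mk j)).subset ?_
    rintro ⟨j, i⟩ hi
    have hi' : f j i x ≠ 0 := by
      intro h0
      refine hi (norm_eq_zero.1 ((hg x (j, i)).trans ?_))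
      rw [h0, abs_zero]
    refine mem_iUnion₂.2 ⟨j, ?_, i, ?_, rfl⟩
    · by_contra hj
      exact hi' (hfD j i x (Submodule.mem_sup_left (P.monotone (not_lt.1 hj) hJ)))
    · by_contra hn
      exact hi' (by rw [hfn j i (not_lt.1 hn)]; rfl)
  have hC := P.C_pos
  have bound : ∀ x, ‖x‖ ≤ 24 * P.C * ‖T x‖ := by
    intro x
    have hcl : IsClosed {x | ‖x‖ ≤ 24 * P.C * ‖T x‖} :=
      isClosed_le continuous_norm (by fun_prop)
    refine closure_minimal ?_ hcl (P.dense x)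
    intro x hx
    obtain ⟨J, hJ⟩ := mem_iUnion.1 hx
    change ‖x‖ ≤ 24 * P.C * ‖T x‖
    refine le_of_forall_pos_le_add fun ε hε => ?_
    have := P.norm_le_of_forall_close hJ (δ := 2 * ‖T x‖ + ε / (12 * P.C)) fun j =>
      hfr j x _ fun i => by
        have := hTi x j i
        have : 0 < ε / (12 * P.C) := by positivity
        linarith
    refine this.trans_eq ?_
    field_simp
    ring
  have hinj : ∀ x, (24 * P.C)⁻¹ * ‖x‖ ≤ ‖T x‖ := fun x => by
    rw [inv_mul_le_iff₀ (by positivity)]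
    exact bound x
  refine ⟨T.codRestrict _ hTmem, ?_, (24 * P.C)⁻¹, by positivity, hinj⟩
  refine (injective_iff_map_eq_zero _).2 fun x hx => ?_
  have h0 : T x = 0 := congr_arg Subtype.val hx
  have := bound x
  rw [h0, norm_zero, mul_zero] at this
  exact norm_le_zero_iff.1 this

end Embedding

section Quotient

variable {X : Type*} [NormedAddCommGroup X] [NormedSpace ℝ X]

lemma exists_quotient_map_L1Block (G : Submodule ℝ X) [FiniteDimensional ℝ G] (j : ℕ) :
    ∃ (n : ℕ) (q : L1Block (j, n) →L[ℝ] X), (∀ c, q c ∈ G) ∧ (∀ c, ‖q c‖ ≤ ‖c‖) ∧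
      ∀ g ∈ G, ∃ c, q c = g ∧ ‖c‖ ≤ 2 * ‖g‖ := by
  obtain ⟨n, v, hv, h⟩ := exists_finite_spanning_family G
  let q : L1Block (j, n) →ₗ[ℝ] X :=
    { toFun := fun c => ∑ i, c i • (v i : X)
      map_add' := fun c d => by simp [add_smul, Finset.sum_add_distrib]
      map_smul' := fun a c => by simp [mul_smul, Finset.smul_sum] }
  have hq : ∀ c, ‖q c‖ ≤ 1 * ‖c‖ := by
    intro c
    rw [one_mul, PiLp.norm_eq_of_L1]
    change ‖∑ i, c i • (v i : X)‖ ≤ _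
    refine norm_sum_le_of_le _ fun i _ => ?_
    rw [norm_smul]
    exact mul_le_of_le_one_right (norm_nonneg _) (hv i)
  refine ⟨n, q.mkContinuous 1 hq, fun c => ?_, fun c => (hq c).trans_eq (one_mul _), ?_⟩
  · change ∑ i, c i • (v i : X) ∈ G
    exact Submodule.sum_mem _ fun i _ => G.smul_mem _ (v i).2
  · intro g hg
    obtain ⟨c, hc, hcg⟩ := h ⟨g, hg⟩
    refine ⟨WithLp.toLp 1 c, ?_, ?_⟩
    · have := congr_arg G.subtype hcg
      rw [map_sum] at this
      exact this
    · rw [PiLp.norm_eq_of_L1]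
      exact hc

lemma C0Sum.exists_eq_on_diagonal (n : ℕ → ℕ) (c : ∀ j, L1Block (j, n j)) {M : ℝ} (hM : 0 ≤ M)
    (hc : ∀ j, ‖c j‖ ≤ M) (J : ℕ) :
    ∃ u : C0Sum, ‖u‖ ≤ M ∧ ∀ j, u.1 (j, n j) = if j < J then c j else 0 := by
  let φ : (i : ℕ × ℕ) → L1Block i := fun i =>
    if h : n i.1 = i.2 ∧ i.1 < J then
      Eq.rec (motive := fun k _ => L1Block (i.1, k)) (c i.1) h.1 else 0
  have hφ : ∀ i, ‖φ i‖ ≤ M := by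
    rintro ⟨j, k⟩
    by_cases h : n j = k ∧ j < J
    · obtain ⟨rfl, hj⟩ := h
      simpa [φ, hj] using hc j
    · simpa [φ, h] using hM
  refine ⟨⟨⟨φ, memℓp_infty ⟨M, by rintro _ ⟨i, rfl⟩; exact hφ i⟩⟩,
    finitelySupported.le_topologicalClosure ?_⟩, C0Sum.norm_le hM hφ, fun j => ?_⟩
  · refine ((Set.finite_Iio J).image fun j => (j, n j)).subset ?_
    rintro ⟨j, k⟩ hi
    by_cases h : n j = k ∧ j < J
    · exact ⟨j, h.2, Prod.ext rfl h.1⟩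
    · exact absurd (dif_neg h) hi
  · by_cases hj : j < J <;> simp [φ, hj]

lemma FlatDecomposition.exists_telescope (P : FlatDecomposition X) {J : ℕ} {x : X}
    (hx : x ∈ P.F J) : ∃ d : ℕ → X, (∀ j, d j ∈ P.F (j + 1)) ∧ (∀ j, d j ∈ P.D j) ∧
      (∀ j, ‖d j‖ ≤ 4 * ‖x‖) ∧ ∑ j ∈ Finset.range J, d j = x := by
  have hdec : ∀ j, ∃ y ∈ P.F j, x - y ∈ P.D j ∧ ‖y‖ ≤ 2 * ‖x‖ ∧ (x ∈ P.F j → y = x) := by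
    intro j
    by_cases hj : x ∈ P.F j
    · exact ⟨x, hj, by simp, by linarith [norm_nonneg x], fun _ => rfl⟩
    · obtain ⟨y, hy, h1, h2⟩ := P.split j x
      exact ⟨y, hy, h1, h2, fun h => absurd h hj⟩
  choose y hy hyD hyn hyx using hdec
  have hy0 : y 0 = 0 := by
    have := hy 0
    rwa [P.F_zero, Submodule.mem_bot] at this
  refine ⟨fun j => y (j + 1) - y j, fun j => ?_, fun j => ?_, fun j => ?_, ?_⟩
  · exact Submodule.sub_mem _ (hy (j + 1)) (P.monotone (Nat.le_succ j) (hy j))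
  · change y (j + 1) - y j ∈ _
    rw [← sub_sub_sub_cancel_left (y j) (y (j + 1)) x]
    exact Submodule.sub_mem _ (hyD j) (P.antitone (Nat.le_succ j) (hyD (j + 1)))
  · change ‖y (j + 1) - y j‖ ≤ _
    linarith [norm_sub_le (y (j + 1)) (y j), hyn j, hyn (j + 1)]
  · rw [Finset.sum_range_sub, hy0, sub_zero, hyx J hx]

lemma exists_continuousLinearMap_tendsto {E : Type*} [NormedAddCommGroup E] [NormedSpace ℝ E]
    [CompleteSpace E] [CompleteSpace X] (Q : ℕ → E →L[ℝ] X)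
    (h : ∀ u, CauchySeq fun m => Q m u) :
    ∃ q : E →L[ℝ] X, ∀ u, Tendsto (fun m => Q m u) atTop (𝓝 (q u)) := by
  choose L hL using fun u => cauchySeq_tendsto_of_complete (h u)
  exact ⟨continuousLinearMapOfTendsto Q (tendsto_pi_nhds.2 hL), hL⟩

lemma FlatDecomposition.isQuotientOf [CompleteSpace X] (P : FlatDecomposition X) :
    IsQuotientOf X C0Sum := by
  have hfin : ∀ j, FiniteDimensional ℝ (P.F (j + 1) ⊓ P.D j : Submodule ℝ X) := fun j =>
    have := P.finiteDimensional (j + 1)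
    Submodule.finiteDimensional_inf_left _ _
  choose n q hqG hqn hqs using fun j => exists_quotient_map_L1Block (P.F (j + 1) ⊓ P.D j) j
  let Q : ℕ → C0Sum →L[ℝ] X := fun m =>
    ∑ j ∈ Finset.range m, (q j).comp (C0Sum.eval (j, n j))
  have hQ : ∀ m u, Q m u = ∑ j ∈ Finset.range m, q j (u.1 (j, n j)) := fun m u => by
    simp [Q, C0Sum.eval_apply]
  have hC := P.C_pos
  have hcauchy : ∀ u, CauchySeq fun m => Q m u := by
    intro u
    refine Metric.cauchySeq_iff'.2 fun ε hε => ?_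
    obtain ⟨t, ht⟩ := u.exists_finite_norm_le (ε := ε / (2 * P.C)) (by positivity)
    obtain ⟨K, hK⟩ : ∃ K, ∀ i ∈ t, i.1 < K :=
      ⟨t.sup Prod.fst + 1, fun i hi => Nat.lt_succ_of_le (Finset.le_sup (f := Prod.fst) hi)⟩
    refine ⟨K, fun m hm => ?_⟩
    have h1 := P.norm_sum_le (fun j => if K ≤ j then q j (u.1 (j, n j)) else 0)
      (ε / (2 * P.C)) (fun j => by
        split_ifs
        exacts [(hqG j _).1, Submodule.zero_mem _]) (fun j => by
        split_ifs
        exacts [(hqG j _).2, Submodule.zero_mem _]) (fun j => by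
        split_ifs with hj
        · exact (hqn j _).trans (ht _ fun hmem => absurd (hK _ hmem) (not_lt.2 hj))
        · rw [norm_zero]; positivity) m
    have h2 : ∑ j ∈ Finset.range m, (if K ≤ j then q j (u.1 (j, n j)) else 0) =
        Q m u - Q K u := by
      rw [hQ, hQ, ← Finset.sum_Ico_eq_sub _ hm, ← Finset.sum_filter]
      congr 1
      ext j
      simp only [Finset.mem_filter, Finset.mem_range, Finset.mem_Ico]
      tauto
    rw [h2] at h1
    rw [dist_eq_norm]
    refine h1.trans_lt ?_
    field_simp
    linarith
  obtain ⟨Qlim, hL⟩ := exists_continuousLinearMap_tendsto Q hcauchy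
  refine ⟨Qlim, fun x => ?_⟩
  let K : AddSubgroup X := (⨆ j, P.F j).toAddSubgroup
  have hmemK : ∀ x, x ∈ K ↔ ∃ j, x ∈ P.F j := fun x =>
    Submodule.mem_iSup_of_directed _ P.monotone.directed_le
  let Q' : NormedAddGroupHom C0Sum X := Qlim.toLinearMap.toAddMonoidHom.mkNormedAddGroupHom ‖Qlim‖
    Qlim.le_opNorm
  have hsurj : Q'.SurjectiveOnWith K 8 := by
    intro x hx
    obtain ⟨J, hJ⟩ := (hmemK x).1 hx
    obtain ⟨d, hdF, hdD, hdn, hdx⟩ := P.exists_telescope hJ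
    choose c hcq hcn using fun j => hqs j (d j) ⟨hdF j, hdD j⟩
    obtain ⟨u, hun, hu⟩ := C0Sum.exists_eq_on_diagonal n c (M := 8 * ‖x‖) (by positivity)
      (fun j => (hcn j).trans (by linarith [hdn j])) J
    refine ⟨u, ?_, hun⟩
    have hconst : ∀ m, J ≤ m → Q m u = x := by
      intro m hm
      rw [hQ, ← hdx, ← Finset.sum_subset (Finset.range_subset_range.2 hm)]
      · refine Finset.sum_congr rfl fun j hj => ?_
        rw [hu, if_pos (Finset.mem_range.1 hj), hcq]
      · intro j _ hj
        rw [hu, if_neg (by simpa using hj), map_zero]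
    exact tendsto_nhds_unique (hL u) (tendsto_const_nhds.congr'
      ((eventually_ge_atTop J).mono fun m hm => (hconst m hm).symm))
  have hcl : x ∈ K.topologicalClosure := by
    refine closure_mono ?_ (P.dense x)
    intro z hz
    exact (hmemK z).2 (mem_iUnion.1 hz)
  obtain ⟨u, hu, -⟩ :=
    controlled_closure_of_complete (by norm_num : (0 : ℝ) < 8) one_pos hsurj x hcl
  exact ⟨u, hu⟩

end Quotient

/-- There exists a separable Banach space `U` admitting an equivalent AUF norm, such that every
separable Banach space admitting an equivalent AUF norm is isomorphic to a closed subspace of `U`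
and is a quotient of `U`. -/
theorem universal_space_for_AUF :
    ∃ (U : Type) (_ : NormedAddCommGroup U) (_ : NormedSpace ℝ U) (_ : CompleteSpace U),
      TopologicalSpace.SeparableSpace U ∧ AUFable U ∧
      ∀ (X : Type u) (_ : NormedAddCommGroup X) (_ : NormedSpace ℝ X) (_ : CompleteSpace X),
        TopologicalSpace.SeparableSpace X → AUFable X →
          IsomToClosedSubspace X U ∧ IsQuotientOf X U := by
  refine ⟨C0Sum, inferInstance, inferInstance, inferInstance, C0Sum.separableSpace,
    C0Sum.aufable, ?_⟩
  intro X _ _ _ hsep hA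
  obtain ⟨P⟩ := hA.nonempty_flatDecomposition
  exact ⟨P.isomToClosedSubspace, P.isQuotientOf⟩
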